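/- Let W_k = ∑_{i=1}^n [α_{k+1}]_i · n[β_k]_i. Then for every k ≥ 0 the Push–Pull iterates satisfy: F(x̂^{k+1}) − F(x̂^k) ≤ −(1/(2η^k W_k))‖x̂^{k+1} − x̂^k‖² + (L_{f,1}/2)‖x̂^{k+1} − x̂^k‖² + (η^k/(2W_k)) · ( 6S(t^k, β_k) + 6L_{f,1}²(n/min_i[α_k]_i) D(x^k, α_k) ) − (η^k/2) W_k ‖∇F(x̂^k)‖². -/

import Mathlib

open scoped BigOperators RealInnerProductSpace

set_option linter.unusedVariables false

noncomputable section

abbrev Euc (d : ℕ) := EuclideanSpace ℝ (Fin d)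

noncomputable def gradX {dx dy : ℕ} (f : Euc dx × Euc dy → ℝ) (x : Euc dx) (y : Euc dy) :
    Euc dx :=
  gradient (fun x' => f (x', y)) x

noncomputable def gradY {dx dy : ℕ} (f : Euc dx × Euc dy → ℝ) (x : Euc dx) (y : Euc dy) :
    Euc dy :=
  gradient (fun y' => f (x, y')) y

noncomputable def consD {n : ℕ} {V : Type*} [NormedAddCommGroup V] [NormedSpace ℝ V]
    (w : Fin n → ℝ) (v : Fin n → V) : ℝ :=
  ∑ i, w i * ‖v i - ∑ j, w j • v j‖ ^ 2

noncomputable def trackS {n : ℕ} {V : Type*} [NormedAddCommGroup V] [NormedSpace ℝ V]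
    (w : Fin n → ℝ) (t : Fin n → V) : ℝ :=
  ∑ j, w j * ‖(w j)⁻¹ • t j - ∑ l, t l‖ ^ 2

theorem norm_sum_smul_sq_le {ι V : Type*} [NormedAddCommGroup V] [NormedSpace ℝ V]
    (s : Finset ι) (w : ι → ℝ) (v : ι → V) (hw : ∀ i ∈ s, 0 ≤ w i) :
    ‖∑ i ∈ s, w i • v i‖ ^ 2 ≤ (∑ i ∈ s, w i) * ∑ i ∈ s, w i * ‖v i‖ ^ 2 := by
  have h1 : ‖∑ i ∈ s, w i • v i‖ ≤ ∑ i ∈ s, w i * ‖v i‖ := by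
    refine (norm_sum_le _ _).trans (Finset.sum_le_sum fun i hi => ?_)
    rw [norm_smul, Real.norm_of_nonneg (hw i hi)]
  refine (pow_le_pow_left₀ (norm_nonneg _) h1 2).trans ?_
  exact Finset.sum_sq_le_sum_mul_sum_of_sq_le_mul s hw
    (fun i hi => mul_nonneg (hw i hi) (sq_nonneg _)) (fun i _ => (by ring : _ = _).le)

/-- The descent lemma for functions with Lipschitz gradient. -/
theorem le_add_inner_gradient_add_sq {V : Type*} [NormedAddCommGroup V] [InnerProductSpace ℝ V]
    [CompleteSpace V] {g : V → ℝ} (hg : Differentiable ℝ g) {L : ℝ}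
    (hL : ∀ p q, ‖gradient g p - gradient g q‖ ≤ L * ‖p - q‖) (x v : V) :
    g (x + v) ≤ g x + ⟪gradient g x, v⟫ + L / 2 * ‖v‖ ^ 2 := by
  set φ : ℝ → ℝ := fun s => g (x + s • v) - s * ⟪gradient g x, v⟫ - L / 2 * ‖v‖ ^ 2 * s ^ 2
    with hφ
  have hderiv : ∀ s, HasDerivAt φ
      (⟪gradient g (x + s • v), v⟫ - ⟪gradient g x, v⟫ - L * ‖v‖ ^ 2 * s) s := by
    intro s
    have h1 : HasDerivAt (fun s : ℝ => x + s • v) v s := by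
      simpa using ((hasDerivAt_id s).smul_const v).const_add x
    have h2 : HasDerivAt (fun s : ℝ => g (x + s • v)) ⟪gradient g (x + s • v), v⟫ s := by
      rw [inner_gradient_left]
      exact (hg _).hasFDerivAt.comp_hasDerivAt s h1
    have h3 := (h2.sub ((hasDerivAt_id s).mul_const ⟪gradient g x, v⟫)).sub
      (((hasDerivAt_id s).pow 2).const_mul (L / 2 * ‖v‖ ^ 2))
    refine h3.congr_deriv ?_
    simp only [id, one_mul, mul_one, Nat.cast_ofNat, Nat.add_one_sub_one, pow_one]
    ring
  have hanti : AntitoneOn φ (Set.Icc 0 1) := by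
    refine antitoneOn_of_deriv_nonpos (convex_Icc 0 1)
      (fun s _ => (hderiv s).continuousAt.continuousWithinAt)
      (fun s _ => (hderiv s).differentiableAt.differentiableWithinAt) fun s hs => ?_
    rw [interior_Icc] at hs
    rw [(hderiv s).deriv, ← inner_sub_left]
    have h1 := real_inner_le_norm (gradient g (x + s • v) - gradient g x) v
    have h2 := hL (x + s • v) x
    rw [add_sub_cancel_left, norm_smul, Real.norm_of_nonneg hs.1.le] at h2
    nlinarith [mul_le_mul_of_nonneg_right h2 (norm_nonneg v)]
  have h := hanti (Set.left_mem_Icc.2 zero_le_one) (Set.right_mem_Icc.2 zero_le_one) zero_le_one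
  simp only [hφ, one_smul, zero_smul, add_zero] at h
  linarith

theorem gradient_const_mul_sum {ι V : Type*} [NormedAddCommGroup V] [InnerProductSpace ℝ V]
    [CompleteSpace V] (s : Finset ι) (c : ℝ) {f : ι → V → ℝ} {p : V}
    (hf : ∀ i ∈ s, DifferentiableAt ℝ (f i) p) :
    gradient (fun p => c * ∑ i ∈ s, f i p) p = c • ∑ i ∈ s, gradient (f i) p := by
  have h : HasFDerivAt (fun p => c * ∑ i ∈ s, f i p) (c • ∑ i ∈ s, fderiv ℝ (f i) p) p :=
    (HasFDerivAt.fun_sum fun i hi => (hf i hi).hasFDerivAt).const_mul c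
  simp only [gradient, h.fderiv, map_smul, map_sum]

/-- Column-stochastic gradient tracking preserves the total of the tracked gradients. -/
theorem sum_tracking_eq {ι V : Type*} [Fintype ι] [AddCommGroup V] [Module ℝ V]
    {B : ℕ → ι → ι → ℝ} (hB : ∀ k j, ∑ i, B k i j = 1) {t g : ℕ → ι → V}
    (ht0 : ∀ i, t 0 i = g 0 i)
    (ht : ∀ k i, t (k + 1) i = (∑ j, B k i j • t k j) + g (k + 1) i - g k i) (k : ℕ) :
    ∑ i, t k i = ∑ i, g k i := by
  induction k with
  | zero => exact Finset.sum_congr rfl fun i _ => ht0 i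
  | succ k ih =>
    simp only [ht, Finset.sum_sub_distrib, Finset.sum_add_distrib]
    rw [Finset.sum_comm]
    simp only [← Finset.sum_smul, hB, one_smul, ih]
    abel

theorem trackS_nonneg {n : ℕ} {V : Type*} [NormedAddCommGroup V] [NormedSpace ℝ V]
    {w : Fin n → ℝ} (hw : ∀ i, 0 ≤ w i) (t : Fin n → V) : 0 ≤ trackS w t :=
  Finset.sum_nonneg fun i _ => mul_nonneg (hw i) (sq_nonneg _)

theorem sum_mul_le_one {ι : Type*} [Fintype ι] {w u : ι → ℝ} (hw : ∀ i, w i ≤ 1)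
    (hu : ∀ i, 0 ≤ u i) (hu1 : ∑ i, u i = 1) : ∑ i, w i * u i ≤ 1 :=
  hu1 ▸ Finset.sum_le_sum fun i _ => mul_le_of_le_one_left (hu i) (hw i)

/-- The mismatch between a weighted sum of the trackers and its mean direction is controlled by
the tracking error. -/
theorem norm_sum_smul_sub_sq_le_trackS {n : ℕ} {V : Type*} [NormedAddCommGroup V]
    [NormedSpace ℝ V] {w u : Fin n → ℝ} (hw0 : ∀ i, 0 ≤ w i) (hw1 : ∀ i, w i ≤ 1)
    (hu0 : ∀ i, 0 < u i) (hu1 : ∑ i, u i = 1) (t : Fin n → V) :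
    ‖∑ i, w i • t i - (∑ i, w i * u i) • ∑ l, t l‖ ^ 2 ≤ trackS u t := by
  have h1 : ∑ i, w i • t i - (∑ i, w i * u i) • ∑ l, t l
      = ∑ i, (w i * u i) • ((u i)⁻¹ • t i - ∑ l, t l) := by
    simp only [smul_sub, Finset.sum_sub_distrib, Finset.sum_smul, smul_smul]
    congr 1
    refine Finset.sum_congr rfl fun i _ => ?_
    rw [mul_assoc, mul_inv_cancel₀ (hu0 i).ne', mul_one]
  have hwu : ∀ i, 0 ≤ w i * u i := fun i => mul_nonneg (hw0 i) (hu0 i).le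
  rw [h1]
  refine (norm_sum_smul_sq_le _ _ _ fun i _ => hwu i).trans ?_
  refine (mul_le_of_le_one_left (Finset.sum_nonneg fun i _ => mul_nonneg (hwu i) (sq_nonneg _))
    (sum_mul_le_one hw1 (fun i => (hu0 i).le) hu1)).trans ?_
  exact Finset.sum_le_sum fun i _ => mul_le_mul_of_nonneg_right
    (mul_le_of_le_one_left (hu0 i).le (hw1 i)) (sq_nonneg _)

theorem norm_sum_gradient_sub_sq_le_consD {n : ℕ} {V : Type*} [NormedAddCommGroup V]
    [NormedSpace ℝ V] {w : Fin n → ℝ} {m : ℝ} (hm : 0 < m) (hmw : ∀ i, m ≤ w i)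
    {g : Fin n → V → V} {L : ℝ} (hL : ∀ i p q, ‖g i p - g i q‖ ≤ L * ‖p - q‖)
    (x : Fin n → V) :
    ‖∑ i, g i (x i) - ∑ i, g i (∑ j, w j • x j)‖ ^ 2 ≤ L ^ 2 * (n / m) * consD w x := by
  have h1 := norm_sum_smul_sq_le Finset.univ (fun _ => 1)
    (fun i => g i (x i) - g i (∑ j, w j • x j)) fun _ _ => zero_le_one
  simp only [one_smul, one_mul, Finset.sum_const, Finset.card_univ, Fintype.card_fin,
    nsmul_eq_mul, mul_one, Finset.sum_sub_distrib] at h1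
  have h2 : ∀ i, ‖g i (x i) - g i (∑ j, w j • x j)‖ ^ 2
      ≤ L ^ 2 / m * (w i * ‖x i - ∑ j, w j • x j‖ ^ 2) := by
    intro i
    refine (pow_le_pow_left₀ (norm_nonneg _) (hL i _ _) 2).trans ?_
    rw [mul_pow, div_mul_eq_mul_div, le_div_iff₀ hm]
    nlinarith [mul_le_mul_of_nonneg_right (hmw i)
      (mul_nonneg (sq_nonneg L) (sq_nonneg ‖x i - ∑ j, w j • x j‖))]
  refine h1.trans ((mul_le_mul_of_nonneg_left (Finset.sum_le_sum fun i _ => h2 i)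
    n.cast_nonneg).trans_eq ?_)
  rw [← Finset.mul_sum, consD]
  ring

/-- Descent along an inexact gradient direction `u` approximating `W • gradient g x`. -/
theorem descent_of_inexact_direction {V : Type*} [NormedAddCommGroup V] [InnerProductSpace ℝ V]
    [CompleteSpace V] {g : V → ℝ} (hg : Differentiable ℝ g) {L : ℝ}
    (hL : ∀ p q, ‖gradient g p - gradient g q‖ ≤ L * ‖p - q‖) {η W E : ℝ} (hη : 0 < η)
    (hW : 0 < W) (x u : V) (hE : ‖u - W • gradient g x‖ ^ 2 ≤ E) :
    g (x - η • u) - g x ≤ -(1 / (2 * η * W)) * ‖x - η • u - x‖ ^ 2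
      + (L / 2) * ‖x - η • u - x‖ ^ 2 + (η / (2 * W)) * E
      - (η / 2) * W * ‖gradient g x‖ ^ 2 := by
  have h := le_add_inner_gradient_add_sq hg hL x (-(η • u))
  rw [← sub_eq_add_neg, norm_neg, inner_neg_right, real_inner_smul_right] at h
  have hx : ‖x - η • u - x‖ = ‖η • u‖ := by rw [sub_sub_cancel_left, norm_neg]
  rw [hx]
  have hu : ‖η • u‖ ^ 2 = η ^ 2 * ‖u‖ ^ 2 := by
    rw [norm_smul, mul_pow, Real.norm_eq_abs, sq_abs]
  have hpolar : ‖u - W • gradient g x‖ ^ 2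
      = ‖u‖ ^ 2 - 2 * (W * ⟪gradient g x, u⟫) + W ^ 2 * ‖gradient g x‖ ^ 2 := by
    rw [norm_sub_sq_real, real_inner_smul_right, real_inner_comm, norm_smul, mul_pow,
      Real.norm_eq_abs, sq_abs]
  have hscaled := mul_le_mul_of_nonneg_left hE (by positivity : 0 ≤ η / (2 * W))
  have hid : η / (2 * W) * ‖u - W • gradient g x‖ ^ 2
      = 1 / (2 * η * W) * ‖η • u‖ ^ 2 - η * ⟪gradient g x, u⟫
        + η / 2 * W * ‖gradient g x‖ ^ 2 := by
    rw [hpolar, hu]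
    field_simp
  linarith

theorem stmt13
    (d n : ℕ) (hd : 0 < d) (hn : 0 < n)
    (f : Fin n → Euc d → ℝ) (Fb : Euc d → ℝ)
    (hFb : ∀ p, Fb p = (1 / (n : ℝ)) * ∑ i, f i p)
    (Lf1 : ℝ)
    (hfC1 : ∀ i, ContDiff ℝ 1 (f i))
    (hfSmooth : ∀ i p q, ‖gradient (f i) p - gradient (f i) q‖ ≤ Lf1 * ‖p - q‖)
    (a b : ℝ) (ha0 : 0 < a) (ha1 : a ≤ 1) (hb0 : 0 < b) (hb1 : b ≤ 1)
    (A B : ℕ → Fin n → Fin n → ℝ)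
    (hA0 : ∀ k i j, 0 ≤ A k i j) (hArow : ∀ k i, ∑ j, A k i j = 1)
    (hAdiag : ∀ k i, 0 < A k i i) (hAa : ∀ k i j, A k i j ≠ 0 → a ≤ A k i j)
    (hB0 : ∀ k i j, 0 ≤ B k i j) (hBcol : ∀ k j, ∑ i, B k i j = 1)
    (hBdiag : ∀ k i, 0 < B k i i) (hBb : ∀ k i j, B k i j ≠ 0 → b ≤ B k i j)
    (av bv : ℕ → Fin n → ℝ)
    (hav0 : ∀ k i, 0 ≤ av k i) (hav1 : ∀ k, ∑ i, av k i = 1)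
    (hbv0 : ∀ k i, 0 ≤ bv k i) (hbv1 : ∀ k, ∑ i, bv k i = 1)
    (havrec : ∀ k j, av (k+1) j = ∑ i, av k i * A k i j)
    (hbvrec : ∀ k i, bv (k+1) i = ∑ j, B k i j * bv k j)
    (havlb : ∀ k i, a ^ n / (n : ℝ) ≤ av k i)
    (hbvlb : ∀ k i, b ^ n / (n : ℝ) ≤ bv k i)
    (η : ℕ → ℝ) (hη : ∀ k, 0 < η k)
    (xv : ℕ → Fin n → Euc d) (t : ℕ → Fin n → Euc d)
    (hxup : ∀ k i, xv (k+1) i = (∑ j, A k i j • xv k j) - η k • t k i)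
    (htup : ∀ k i, t (k+1) i = (∑ j, B k i j • t k j) + gradient (f i) (xv (k+1) i) - gradient (f i) (xv k i))
    (ht0 : ∀ i, t 0 i = gradient (f i) (xv 0 i))
    (xhat : ℕ → Euc d) (hxhat : ∀ k, xhat k = ∑ i, av k i • xv k i)
    (hxhatdyn : ∀ k, xhat (k+1) = xhat k - η k • ∑ i, av (k+1) i • t k i)
    (xbar : ℕ → Euc d)
    (hxbar : ∀ k, xbar k = (1 / (n : ℝ)) • ∑ i, xv k i) :
    ∀ k : ℕ,
      Fb (xhat (k+1)) - Fb (xhat k) ≤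
        -(1 / (2 * η k * (∑ i, av (k+1) i * ((n : ℝ) * bv k i)))) * ‖xhat (k+1) - xhat k‖ ^ 2
        + (Lf1 / 2) * ‖xhat (k+1) - xhat k‖ ^ 2
        + (η k / (2 * (∑ i, av (k+1) i * ((n : ℝ) * bv k i)))) *
            (6 * trackS (bv k) (t k)
              + 6 * Lf1 ^ 2 * ((n : ℝ) / (⨅ i, av k i)) * consD (av k) (xv k))
        - (η k / 2) * (∑ i, av (k+1) i * ((n : ℝ) * bv k i)) * ‖gradient Fb (xhat k)‖ ^ 2 := by
  intro k
  have hn' : (0 : ℝ) < n := Nat.cast_pos.2 hn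
  have : Nonempty (Fin n) := ⟨⟨0, hn⟩⟩
  have hdiff : ∀ i, Differentiable ℝ (f i) := fun i => (hfC1 i).differentiable one_ne_zero
  obtain rfl : Fb = fun p => (1 / (n : ℝ)) * ∑ i, f i p := funext hFb
  have hgrad : ∀ p, gradient (fun p => (1 / (n : ℝ)) * ∑ i, f i p) p
      = (1 / (n : ℝ)) • ∑ i, gradient (f i) p := fun p =>
    gradient_const_mul_sum _ _ fun i _ => hdiff i p
  have hFdiff : Differentiable ℝ fun p => (1 / (n : ℝ)) * ∑ i, f i p :=
    (Differentiable.fun_sum fun i _ => hdiff i).const_mul _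
  have hFlip : ∀ p q, ‖gradient (fun p => (1 / (n : ℝ)) * ∑ i, f i p) p
      - gradient (fun p => (1 / (n : ℝ)) * ∑ i, f i p) q‖ ≤ Lf1 * ‖p - q‖ := by
    intro p q
    rw [hgrad, hgrad, ← smul_sub, ← Finset.sum_sub_distrib, norm_smul,
      Real.norm_of_nonneg (by positivity), one_div, inv_mul_le_iff₀ hn']
    refine (norm_sum_le_of_le _ fun i _ => hfSmooth i p q).trans_eq ?_
    simp
  have hbpos : ∀ i, 0 < bv k i := fun i => lt_of_lt_of_le (by positivity) (hbvlb k i)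
  have ha1' : ∀ i, av (k + 1) i ≤ 1 := fun i =>
    hav1 (k + 1) ▸ Finset.single_le_sum (fun j _ => hav0 (k + 1) j) (Finset.mem_univ i)
  have hapos : ∀ i, 0 < av (k + 1) i := fun i => lt_of_lt_of_le (by positivity) (havlb (k + 1) i)
  have hW : 0 < ∑ i, av (k + 1) i * ((n : ℝ) * bv k i) :=
    Finset.sum_pos (fun i _ => mul_pos (hapos i) (mul_pos hn' (hbpos i))) Finset.univ_nonempty
  have hWeq : ∑ i, av (k + 1) i * ((n : ℝ) * bv k i) = (∑ i, av (k + 1) i * bv k i) * n := by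
    rw [Finset.sum_mul]
    exact Finset.sum_congr rfl fun i _ => by ring
  have hmin : 0 < ⨅ i, av k i :=
    lt_of_lt_of_le (by positivity : 0 < a ^ n / (n : ℝ)) (le_ciInf (havlb k))
  have hmin_le : ∀ i, ⨅ i, av k i ≤ av k i := fun i => ciInf_le (Set.finite_range _).bddBelow i
  have hsum := sum_tracking_eq (g := fun k i => gradient (f i) (xv k i)) hBcol ht0 htup k
  have htrack := norm_sum_smul_sub_sq_le_trackS (hav0 (k + 1)) ha1' hbpos (hbv1 k) (t k)
  have hcons := norm_sum_gradient_sub_sq_le_consD hmin hmin_le hfSmooth (xv k)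
  rw [← hxhat k, ← hsum] at hcons
  rw [hxhatdyn k]
  refine descent_of_inexact_direction hFdiff hFlip (hη k) hW _ _ ?_
  set c := ∑ i, av (k + 1) i * bv k i
  have hc0 : 0 ≤ c := Finset.sum_nonneg fun i _ => mul_nonneg (hav0 _ i) (hbv0 k i)
  have hc1 : c ≤ 1 := sum_mul_le_one ha1' (hbv0 k) (hbv1 k)
  have hsplit : ∑ i, av (k + 1) i • t k i - (∑ i, av (k + 1) i * ((n : ℝ) * bv k i)) •
        gradient (fun p => (1 / (n : ℝ)) * ∑ i, f i p) (xhat k)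
      = (∑ i, av (k + 1) i • t k i - c • ∑ l, t k l)
        + c • (∑ l, t k l - ∑ i, gradient (f i) (xhat k)) := by
    rw [hgrad, hWeq, smul_smul, mul_assoc, mul_one_div_cancel hn'.ne', mul_one, smul_sub]
    abel
  have hsmul : ‖c • (∑ l, t k l - ∑ i, gradient (f i) (xhat k))‖ ^ 2
      ≤ ‖∑ l, t k l - ∑ i, gradient (f i) (xhat k)‖ ^ 2 := by
    rw [norm_smul, Real.norm_of_nonneg hc0]
    gcongr
    exact mul_le_of_le_one_left (norm_nonneg _) hc1
  have hS := trackS_nonneg (hbv0 k) (t k)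
  have hD : 0 ≤ Lf1 ^ 2 * ((n : ℝ) / ⨅ i, av k i) * consD (av k) (xv k) :=
    (sq_nonneg _).trans hcons
  rw [hsplit]
  refine (pow_le_pow_left₀ (norm_nonneg _) (norm_add_le _ _) 2).trans ?_
  refine add_sq_le.trans ?_
  linarith
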